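/- Let u : ℤ → ℝ → ℝ be such that each u_n is differentiable, u_{n+1}(t) ≠ u_{n−1}(t) for all n ∈ ℤ and t ∈ ℝ, and u solves du_n/dt = (2u_nu_{n+1}u_{n−1} − u_n²(u_{n+1} + u_{n−1}))/(u_{n+1} − u_{n−1}). Then each of the following again satisfies v_{n+1}(t) ≠ v_{n−1}(t) and solves the same equation: (i) v_n(t) = s·u_n(st) for any s ≠ 0; (ii) v_n(t) = u_n(t)/(1 − ε·u_n(t)) for any ε ∈ ℝ such that 1 − ε·u_m(t) ≠ 0 for all m, t. These are the one-parameter groups generated by X₁ = t∂_t − u_n∂_{u_n} and X₂ = u_n²∂_{u_n} of the nonintegrable equation with three-dimensional symmetry algebra. -/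

import Mathlib

/-- `u` solves du_n/dt = (2u_n u_{n+1} u_{n−1} − u_n²(u_{n+1}+u_{n−1}))/(u_{n+1} − u_{n−1}). -/
def SolvesEq48 (u : ℤ → ℝ → ℝ) : Prop :=
  ∀ (n : ℤ) (t : ℝ),
    HasDerivAt (u n)
      ((2 * u n t * u (n + 1) t * u (n - 1) t
        - (u n t) ^ 2 * (u (n + 1) t + u (n - 1) t))
       / (u (n + 1) t - u (n - 1) t)) t

/-- `v` is again admissible: neighbours stay distinct and it solves the same equation. -/
def GoodEq48 (v : ℤ → ℝ → ℝ) : Prop :=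
  (∀ (n : ℤ) (t : ℝ), v (n + 1) t ≠ v (n - 1) t) ∧ SolvesEq48 v

/-- The scaling group `t∂_t − u∂_u` of the equation. -/
theorem GoodEq48.scale {u : ℤ → ℝ → ℝ} (hu : GoodEq48 u) {s : ℝ} (hs : s ≠ 0) :
    GoodEq48 (fun n t => s * u n (s * t)) := by
  refine ⟨fun n t h => hu.1 n (s * t) (mul_left_cancel₀ hs h), fun n t => ?_⟩
  have hd : u (n + 1) (s * t) - u (n - 1) (s * t) ≠ 0 := sub_ne_zero.2 (hu.1 n (s * t))
  have hlin : HasDerivAt (fun t => s * t) s t := by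
    simpa using (hasDerivAt_id t).const_mul s
  refine (((hu.2 n (s * t)).comp t hlin).const_mul s).congr_deriv ?_
  rw [← mul_sub]
  field_simp

/-- The projective group `u²∂_u` of the equation. -/
theorem GoodEq48.projective {u : ℤ → ℝ → ℝ} (hu : GoodEq48 u) {ε : ℝ}
    (hε : ∀ (m : ℤ) (t : ℝ), 1 - ε * u m t ≠ 0) :
    GoodEq48 (fun n t => u n t / (1 - ε * u n t)) := by
  refine ⟨fun n t h => hu.1 n t ?_, fun n t => ?_⟩
  · rw [div_eq_div_iff (hε _ t) (hε _ t)] at h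
    linear_combination h
  · have hd := sub_ne_zero.2 (hu.1 n t)
    have hder := hu.2 n t
    have h₀ := hε n t
    have h₁ := hε (n + 1) t
    have h₂ := hε (n - 1) t
    refine (hder.fun_div ((hder.const_mul ε).const_sub 1) h₀).congr_deriv ?_
    clear hder
    beta_reduce
    generalize u n t = x, u (n + 1) t = y, u (n - 1) t = z at *
    have hsub : y / (1 - ε * y) - z / (1 - ε * z) =
        (y - z) / ((1 - ε * y) * (1 - ε * z)) := by
      rw [div_sub_div _ _ h₁ h₂]
      ring
    rw [hsub]
    generalize ha : 1 - ε * x = a, hb : 1 - ε * y = b, hc : 1 - ε * z = c at *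
    field_simp
    subst ha hb hc
    ring

theorem eq48_symmetry_groups (u : ℤ → ℝ → ℝ)
    (hneq : ∀ (n : ℤ) (t : ℝ), u (n + 1) t ≠ u (n - 1) t)
    (hsol : SolvesEq48 u) :
    (∀ s : ℝ, s ≠ 0 → GoodEq48 (fun n t => s * u n (s * t))) ∧
    (∀ ε : ℝ, (∀ (m : ℤ) (t : ℝ), 1 - ε * u m t ≠ 0) →
      GoodEq48 (fun n t => u n t / (1 - ε * u n t))) := by
  exact ⟨fun _ hs => GoodEq48.scale ⟨hneq, hsol⟩ hs,
    fun _ hε => GoodEq48.projective ⟨hneq, hsol⟩ hε⟩
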